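/- arXiv:2510.12221 — 2 statements merged into one kernel-verified Lean document; each statement's English description precedes it below -/
import Mathlib

section
/- There exists a universal constant C > 0 with the following property: for all signs σ, σ₂, σ₃, σ₄ ∈ {−1, 1}, all dyadic numbers N₂, N₃, N₃₄, and every m ∈ ℤ, the cardinality of the set { (n₂, n₃, n₄) ∈ (ℤ²)³ : |n₂| ∼ N₂, |n₃| ∼ N₃, |n₃+n₄| ∼ N₃₄ and |ψ(n₂,n₃,n₄) − m| ≤ 1 } is at most C · (N₂ · N₃ · N₃₄)² / min(N₃₄, max(N₂, N₃))^{1/2}. -/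
/-- The Euclidean norm of a lattice point `x ∈ ℤ²`. -/
noncomputable def znorm (x : Fin 2 → ℤ) : ℝ :=
  Real.sqrt ((x 0 : ℝ) ^ 2 + (x 1 : ℝ) ^ 2)

/-- The Japanese bracket `⟨x⟩ = √(1 + |x|²)` for lattice points `x ∈ ℤ²`. -/
noncomputable def jb (x : Fin 2 → ℤ) : ℝ :=
  Real.sqrt (1 + (x 0 : ℝ) ^ 2 + (x 1 : ℝ) ^ 2)

/-- `|x| ∼ N`, i.e. `N/2 ≤ |x| ≤ 2N`. -/
def ann (N : ℝ) (x : Fin 2 → ℤ) : Prop :=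
  N / 2 ≤ znorm x ∧ znorm x ≤ 2 * N

/-- The cubic phase function `φ(n₁,n₂,n₃) = σ⟨n₁+n₂+n₃⟩ + σ₁⟨n₁⟩ + σ₂⟨n₂⟩ + σ₃⟨n₃⟩`. -/
noncomputable def phase (σ σ₁ σ₂ σ₃ : ℝ) (n₁ n₂ n₃ : Fin 2 → ℤ) : ℝ :=
  σ * jb (n₁ + n₂ + n₃) + σ₁ * jb n₁ + σ₂ * jb n₂ + σ₃ * jb n₃

/-- The median (middle value) of three real numbers. -/
noncomputable def med3 (a b c : ℝ) : ℝ :=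
  max (min a b) (min (max a b) c)

/-- The counting set of the cubic counting estimate (iii): variables `(n₂, n₃, n₄)` with
constraints `|n₂| ∼ N₂`, `|n₃| ∼ N₃`, `|n₃+n₄| ∼ N₃₄` and `|ψ(n₂,n₃,n₄) − m| ≤ 1`, where
`ψ(n₂,n₃,n₄) = σ⟨n₂+n₃+n₄⟩ + σ₂⟨n₂⟩ + σ₃⟨n₃⟩ + σ₄⟨n₄⟩`. -/
def cubicSetIII (σ σ₂ σ₃ σ₄ N₂ N₃ N₃₄ : ℝ) (m : ℤ) : Set (Fin 3 → Fin 2 → ℤ) :=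
  {v | ann N₂ (v 0) ∧ ann N₃ (v 1) ∧ ann N₃₄ (v 1 + v 2) ∧
    |phase σ σ₂ σ₃ σ₄ (v 0) (v 1) (v 2) - (m : ℝ)| ≤ 1}

/-- A finite family of integers of diameter at most `K` has at most `K + 1` elements. -/
lemma card_le_of_pairwise_sub_le {T : Finset ℤ} {K : ℝ} (hK : 0 ≤ K)
    (h : ∀ x ∈ T, ∀ y ∈ T, (x : ℝ) - y ≤ K) : (T.card : ℝ) ≤ K + 1 := by
  rcases T.eq_empty_or_nonempty with rfl | hT
  · simpa using by linarith
  · have hsub : T ⊆ Finset.Icc (T.min' hT) (T.max' hT) := fun x hx =>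
      Finset.mem_Icc.2 ⟨T.min'_le x hx, T.le_max' x hx⟩
    have h1 : T.card ≤ (T.max' hT + 1 - T.min' hT).toNat := by
      simpa using Finset.card_le_card hsub
    have h2 : T.min' hT ≤ T.max' hT := T.min'_le _ (T.max'_mem hT)
    have h3 : (T.card : ℤ) ≤ T.max' hT + 1 - T.min' hT := by omega
    have h4 : (T.card : ℝ) ≤ (T.max' hT : ℝ) + 1 - (T.min' hT : ℝ) := by exact_mod_cast h3
    linarith [h _ (T.max'_mem hT) _ (T.min'_mem hT)]

/-- The integer parts of a real family of diameter at most `R` take at most `R + 2` values. -/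
lemma card_image_floor_le {ι : Type*} {S : Finset ι} {g : ι → ℝ} {R : ℝ} (hR : 0 ≤ R)
    (h : ∀ x ∈ S, ∀ y ∈ S, g x - g y ≤ R) :
    ((S.image fun x => ⌊g x⌋).card : ℝ) ≤ R + 2 := by
  have := card_le_of_pairwise_sub_le (T := S.image fun x => ⌊g x⌋) (K := R + 1) (by linarith) (by
    simp only [Finset.mem_image]
    rintro _ ⟨x, hx, rfl⟩ _ ⟨y, hy, rfl⟩
    linarith [h x hx y hy, Int.floor_le (g x), Int.lt_floor_add_one (g y)])
  linarith

/-- A set whose fibers under `f` have at most `c` elements and whose image has at most `d`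
elements has at most `c * d` elements. -/
lemma card_le_mul_of_fiber_le {ι κ : Type*} [DecidableEq κ] {S : Finset ι} {f : ι → κ} {c d : ℝ}
    (hc : 0 ≤ c) (hf : ∀ y ∈ S, ((S.filter fun x => f x = f y).card : ℝ) ≤ c)
    (hd : ((S.image f).card : ℝ) ≤ d) : (S.card : ℝ) ≤ c * d := by
  rw [Finset.card_eq_sum_card_image f S]
  push_cast
  calc ∑ b ∈ S.image f, ((S.filter fun x => f x = b).card : ℝ)
      ≤ ∑ b ∈ S.image f, c := by
        refine Finset.sum_le_sum fun b hb => ?_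
        obtain ⟨y, hy, rfl⟩ := Finset.mem_image.1 hb
        exact hf y hy
    _ = c * (S.image f).card := by rw [Finset.sum_const, nsmul_eq_mul, mul_comm]
    _ ≤ c * d := mul_le_mul_of_nonneg_left hd hc

/-- The coordinate of `n` along the direction `(p, q)`. -/
def coordAlong (p q : ℝ) (n : Fin 2 → ℤ) : ℝ := p * n 0 + q * n 1

/-- The coordinate of `n` across the direction `(p, q)`. -/
def coordAcross (p q : ℝ) (n : Fin 2 → ℤ) : ℝ := p * n 1 - q * n 0

lemma coordAlong_sq_add_coordAcross_sq {p q : ℝ} (hpq : p ^ 2 + q ^ 2 = 1) (n : Fin 2 → ℤ) :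
    coordAlong p q n ^ 2 + coordAcross p q n ^ 2 = (n 0 : ℝ) ^ 2 + (n 1 : ℝ) ^ 2 := by
  unfold coordAlong coordAcross
  linear_combination ((n 0 : ℝ) ^ 2 + (n 1 : ℝ) ^ 2) * hpq

/-- Rotated half-unit cells contain at most one lattice point. -/
lemma eq_of_floor_coord_eq {p q : ℝ} (hpq : p ^ 2 + q ^ 2 = 1) {n n' : Fin 2 → ℤ}
    (h1 : ⌊2 * coordAlong p q n⌋ = ⌊2 * coordAlong p q n'⌋)
    (h2 : ⌊2 * coordAcross p q n⌋ = ⌊2 * coordAcross p q n'⌋) : n = n' := by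
  have h1' := abs_lt.1 (Int.abs_sub_lt_one_of_floor_eq_floor h1)
  have h2' := abs_lt.1 (Int.abs_sub_lt_one_of_floor_eq_floor h2)
  have hsq := coordAlong_sq_add_coordAcross_sq hpq (n - n')
  have e1 : coordAlong p q (n - n') = coordAlong p q n - coordAlong p q n' := by
    simp [coordAlong]; ring
  have e2 : coordAcross p q (n - n') = coordAcross p q n - coordAcross p q n' := by
    simp [coordAcross]; ring
  rw [e1, e2] at hsq
  have hlt : (((n - n') 0 : ℤ) : ℝ) ^ 2 + (((n - n') 1 : ℤ) : ℝ) ^ 2 < 1 := by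
    rw [← hsq]; nlinarith
  have hlt' : (n - n') 0 ^ 2 + (n - n') 1 ^ 2 < 1 := by exact_mod_cast hlt
  have z0 : (n - n') 0 = 0 := by nlinarith [sq_nonneg ((n - n') 0), sq_nonneg ((n - n') 1)]
  have z1 : (n - n') 1 = 0 := by nlinarith [sq_nonneg ((n - n') 0), sq_nonneg ((n - n') 1)]
  simp only [Pi.sub_apply] at z0 z1
  ext i
  fin_cases i
  · simpa using by omega
  · simpa using by omega

lemma jb_sq (n : Fin 2 → ℤ) : jb n ^ 2 = 1 + (n 0 : ℝ) ^ 2 + (n 1 : ℝ) ^ 2 :=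
  Real.sq_sqrt (by positivity)

lemma jb_nonneg (n : Fin 2 → ℤ) : 0 ≤ jb n := Real.sqrt_nonneg _

lemma znorm_sq (n : Fin 2 → ℤ) : znorm n ^ 2 = (n 0 : ℝ) ^ 2 + (n 1 : ℝ) ^ 2 :=
  Real.sq_sqrt (by positivity)

lemma znorm_nonneg (n : Fin 2 → ℤ) : 0 ≤ znorm n := Real.sqrt_nonneg _

lemma znorm_neg (n : Fin 2 → ℤ) : znorm (-n) = znorm n := by simp [znorm]

lemma jb_neg (n : Fin 2 → ℤ) : jb (-n) = jb n := by simp [jb]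

lemma jb_le_of_znorm_le {N : ℝ} (hN : 1 ≤ N) {n : Fin 2 → ℤ} (h : znorm n ≤ 2 * N) :
    jb n ≤ 3 * N := by
  refine abs_le_of_sq_le_sq' ?_ (by linarith) |>.2
  have := znorm_nonneg n
  nlinarith [jb_sq n, znorm_sq n]

lemma abs_sign_mul {σ x : ℝ} (hσ : σ = -1 ∨ σ = 1) : |σ * x| = |x| := by
  rcases hσ with rfl | rfl <;> simp

/-- The lattice points of norm at most `2 * N` within distance `D` of the axis `(p, q)`. -/
lemma card_le_of_abs_coordAcross_le {p q N D : ℝ} (hpq : p ^ 2 + q ^ 2 = 1) (hN : 1 ≤ N)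
    (hD : 1 ≤ D) {S : Finset (Fin 2 → ℤ)}
    (hS : ∀ n ∈ S, znorm n ≤ 2 * N) (hv : ∀ n ∈ S, |coordAcross p q n| ≤ D) :
    (S.card : ℝ) ≤ 60 * N * D := by
  have hu : ∀ n ∈ S, |coordAlong p q n| ≤ 2 * N := fun n hn => by
    refine abs_le_of_sq_le_sq ?_ (by linarith)
    have := hS n hn
    nlinarith [znorm_nonneg n, znorm_sq n, coordAlong_sq_add_coordAcross_sq hpq n,
      sq_nonneg (coordAcross p q n)]
  have key := card_le_mul_of_fiber_le (S := S) (f := fun n => ⌊2 * coordAlong p q n⌋)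
    (c := 4 * D + 2) (d := 8 * N + 2) (by positivity) (fun y _ => by
      rw [← Finset.card_image_of_injOn (f := fun n => ⌊2 * coordAcross p q n⌋)]
      · refine card_image_floor_le (by positivity) fun x hx y hy => ?_
        have hx' := abs_le.1 (hv x (Finset.mem_filter.1 hx).1)
        have hy' := abs_le.1 (hv y (Finset.mem_filter.1 hy).1)
        linarith
      · intro x hx x' hx' h
        exact eq_of_floor_coord_eq hpq
          ((Finset.mem_filter.1 hx).2.trans (Finset.mem_filter.1 hx').2.symm) h)
    (card_image_floor_le (by positivity) fun x hx y hy => by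
      have hx' := abs_le.1 (hu x hx)
      have hy' := abs_le.1 (hu y hy)
      linarith)
  calc (S.card : ℝ) ≤ (4 * D + 2) * (8 * N + 2) := key
    _ ≤ (6 * D) * (10 * N) := by gcongr <;> linarith
    _ = 60 * N * D := by ring

/-- If `⟨n⟩` and `⟨n'⟩` are close and the binary phases of `n` and `n'` are close, then so are the
coordinates of `n` and `n'` along the shift. -/
lemma coordAlong_sub_le {p q α A N Q σ σ' t : ℝ} (hpq : p ^ 2 + q ^ 2 = 1) (hN : 1 ≤ N)
    (hA : 1 ≤ A) (hQ : 1 ≤ Q) (hQN : Q ^ 2 ≤ N) (hQA : Q ^ 2 ≤ A) (hσ : σ = -1 ∨ σ = 1)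
    (hσ' : σ' = -1 ∨ σ' = 1) {a : Fin 2 → ℤ} (ha0 : (a 0 : ℝ) = α * p) (ha1 : (a 1 : ℝ) = α * q)
    (hα1 : A / 2 ≤ |α|) (hα2 : |α| ≤ 2 * A) {n n' : Fin 2 → ℤ} (hn : znorm n ≤ 2 * N)
    (hn' : znorm n' ≤ 2 * N) (hr : |jb n - jb n'| ≤ 1)
    (ht : |σ * jb (a + n) + σ' * jb n - t| ≤ 1) (ht' : |σ * jb (a + n') + σ' * jb n' - t| ≤ 1) :
    coordAlong p q n - coordAlong p q n' ≤ 36 * N / Q ^ 2 := by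
  have hw : |jb (a + n) - jb (a + n')| ≤ 3 := by
    rw [← abs_sign_mul hσ]
    have h1 : |σ' * (jb n - jb n')| ≤ 1 := by rwa [abs_sign_mul hσ']
    rw [abs_le] at *
    constructor <;> linarith
  have hexp : ∀ m : Fin 2 → ℤ,
      jb (a + m) ^ 2 = jb m ^ 2 + α ^ 2 + 2 * α * coordAlong p q m := fun m => by
    rw [jb_sq, jb_sq, coordAlong]
    simp only [Pi.add_apply, Int.cast_add, ha0, ha1]
    linear_combination α ^ 2 * hpq
  have hwle : ∀ m : Fin 2 → ℤ, znorm m ≤ 2 * N → jb (a + m) ≤ 3 * N + 2 * A := fun m hm => by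
    have hr3 := jb_le_of_znorm_le hN hm
    have hum : |coordAlong p q m| ≤ jb m := by
      refine abs_le_of_sq_le_sq ?_ (jb_nonneg m)
      nlinarith [jb_sq m, coordAlong_sq_add_coordAcross_sq hpq m, sq_nonneg (coordAcross p q m)]
    have h1 : α * coordAlong p q m ≤ |α| * jb m :=
      (le_abs_self _).trans (by rw [abs_mul]; gcongr)
    have h2 : jb (a + m) ≤ jb m + |α| := by
      refine abs_le_of_sq_le_sq' ?_ (add_nonneg (jb_nonneg m) (abs_nonneg α)) |>.2
      nlinarith [hexp m, sq_abs α]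
    linarith
  have hdiff : |2 * α * (coordAlong p q n - coordAlong p q n')| ≤ 24 * N + 12 * A := by
    have e : 2 * α * (coordAlong p q n - coordAlong p q n') =
        (jb (a + n) - jb (a + n')) * (jb (a + n) + jb (a + n')) -
          (jb n - jb n') * (jb n + jb n') := by
      linear_combination hexp n' - hexp n
    have b1 : |(jb (a + n) - jb (a + n')) * (jb (a + n) + jb (a + n'))| ≤
        3 * (6 * N + 4 * A) := by
      rw [abs_mul, abs_of_nonneg (add_nonneg (jb_nonneg _) (jb_nonneg _))]
      exact mul_le_mul hw (by linarith [hwle n hn, hwle n' hn'])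
        (add_nonneg (jb_nonneg _) (jb_nonneg _)) (by norm_num)
    have b2 : |(jb n - jb n') * (jb n + jb n')| ≤ 1 * (6 * N) := by
      rw [abs_mul, abs_of_nonneg (add_nonneg (jb_nonneg n) (jb_nonneg n'))]
      exact mul_le_mul hr (by linarith [jb_le_of_znorm_le hN hn, jb_le_of_znorm_le hN hn'])
        (add_nonneg (jb_nonneg _) (jb_nonneg _)) zero_le_one
    rw [e]
    refine (abs_sub _ _).trans ?_
    linarith
  set w := coordAlong p q n - coordAlong p q n'
  have hAw : A * |w| ≤ 24 * N + 12 * A := by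
    rw [abs_mul, abs_mul, abs_of_pos (by norm_num : (0 : ℝ) < 2)] at hdiff
    nlinarith [abs_nonneg w]
  refine (le_abs_self w).trans ?_
  rw [le_div_iff₀ (by positivity)]
  have hQ2 : (24 * N + 12 * A) * Q ^ 2 ≤ A * (36 * N) := by nlinarith
  refine le_of_mul_le_mul_left ?_ (by linarith : 0 < A)
  calc A * (|w| * Q ^ 2) = A * |w| * Q ^ 2 := by ring
    _ ≤ (24 * N + 12 * A) * Q ^ 2 := by gcongr
    _ ≤ _ := hQ2

/-- The binary counting estimate away from the axis `(p, q)` of the shift, on one side of it. -/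
lemma card_le_of_lt_coordAcross {p q α A N Q σ σ' t : ℝ} (hpq : p ^ 2 + q ^ 2 = 1) (hN : 1 ≤ N)
    (hA : 1 ≤ A) (hQ : 1 ≤ Q) (hQN : Q ^ 2 ≤ N) (hQA : Q ^ 2 ≤ A) (hσ : σ = -1 ∨ σ = 1)
    (hσ' : σ' = -1 ∨ σ' = 1) {a : Fin 2 → ℤ} (ha0 : (a 0 : ℝ) = α * p) (ha1 : (a 1 : ℝ) = α * q)
    (hα1 : A / 2 ≤ |α|) (hα2 : |α| ≤ 2 * A) {S : Finset (Fin 2 → ℤ)}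
    (hS : ∀ n ∈ S, znorm n ≤ 2 * N)
    (ht : ∀ n ∈ S, |σ * jb (a + n) + σ' * jb n - t| ≤ 1)
    (hv : ∀ n ∈ S, N / Q < coordAcross p q n) :
    (S.card : ℝ) ≤ 5000 * N ^ 2 / Q := by
  have hQ0 : 0 < Q := by linarith
  have hNQ : 1 ≤ N / Q ^ 2 := by rwa [le_div_iff₀ (by positivity), one_mul]
  have key := card_le_mul_of_fiber_le (S := S) (f := fun n => ⌊jb n⌋)
    (c := (9 * Q + 2) * (72 * (N / Q ^ 2) + 2)) (d := 3 * N + 2) (by positivity) (fun y _ => by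
      refine card_le_mul_of_fiber_le (f := fun n => ⌊2 * coordAlong p q n⌋) (by positivity)
        (fun z _ => ?_) ?_
      · rw [← Finset.card_image_of_injOn (f := fun n => ⌊2 * coordAcross p q n⌋)]
        · refine card_image_floor_le (by positivity) fun x hx x' hx' => ?_
          simp only [Finset.mem_filter] at hx hx'
          have hr := abs_lt.1 (Int.abs_sub_lt_one_of_floor_eq_floor (hx.1.2.trans hx'.1.2.symm))
          have hu := abs_lt.1 (Int.abs_sub_lt_one_of_floor_eq_floor (hx.2.trans hx'.2.symm))
          have hvx := hv x hx.1.1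
          have hvx' := hv x' hx'.1.1
          have hx3 := jb_le_of_znorm_le hN (hS x hx.1.1)
          have hx3' := jb_le_of_znorm_le hN (hS x' hx'.1.1)
          have h0 := jb_nonneg x
          have h0' := jb_nonneg x'
          have hjx := jb_sq x
          have hjx' := jb_sq x'
          rw [add_assoc, ← coordAlong_sq_add_coordAcross_sq hpq] at hjx hjx'
          have hux : |coordAlong p q x| ≤ jb x :=
            abs_le_of_sq_le_sq (by nlinarith [sq_nonneg (coordAcross p q x)]) h0
          have hux' : |coordAlong p q x'| ≤ jb x' :=
            abs_le_of_sq_le_sq (by nlinarith [sq_nonneg (coordAcross p q x')]) h0'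
          set u := coordAlong p q x
          set u' := coordAlong p q x'
          set v := coordAcross p q x
          set v' := coordAcross p q x'
          have b1 : (jb x - jb x') * (jb x + jb x') ≤ 1 * (6 * N) := by
            gcongr
            · exact hr.2.le
            · linarith
          have b2 : |(u' - u) * (u + u')| ≤ 1 / 2 * (6 * N) := by
            rw [abs_mul]
            gcongr
            · exact abs_le.2 ⟨by linarith, by linarith⟩
            · exact (abs_add_le _ _).trans (by linarith)
          have b3 : (v - v') * (v + v') ≤ 9 * N := by
            have := (le_abs_self _).trans b2
            nlinarith
          by_contra! hcon
          have hDQ : N / Q * Q = N := by field_simp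
          have hpos : 0 < N / Q := by positivity
          have : 9 / 2 * Q * (2 * (N / Q)) < (v - v') * (v + v') := by
            apply mul_lt_mul'' <;> first | positivity | linarith
          nlinarith
        · intro x hx x' hx' h
          exact eq_of_floor_coord_eq hpq
            ((Finset.mem_filter.1 hx).2.trans (Finset.mem_filter.1 hx').2.symm) h
      · refine card_image_floor_le (by positivity) fun x hx x' hx' => ?_
        rw [Finset.mem_filter] at hx hx'
        have := coordAlong_sub_le hpq hN hA hQ hQN hQA hσ hσ' ha0 ha1 hα1 hα2 (hS x hx.1)
          (hS x' hx'.1) (Int.abs_sub_lt_one_of_floor_eq_floor (hx.2.trans hx'.2.symm)).le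
          (ht x hx.1) (ht x' hx'.1)
        rw [mul_div_assoc] at this
        linarith)
    (card_image_floor_le (by positivity) fun x hx y hy => by
      linarith [jb_le_of_znorm_le hN (hS x hx), jb_nonneg y])
  calc (S.card : ℝ) ≤ (9 * Q + 2) * (72 * (N / Q ^ 2) + 2) * (3 * N + 2) := key
    _ ≤ (11 * Q) * (74 * (N / Q ^ 2)) * (5 * N) := by gcongr <;> linarith
    _ = 4070 * (N ^ 2 / Q) := by field_simp; ring
    _ ≤ 5000 * (N ^ 2 / Q) := by gcongr; norm_num
    _ = 5000 * N ^ 2 / Q := by ring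

/-- The binary counting estimate: for a shift `a` of size `A`, at most
`O(N² / min(A, N)^{1/2})` lattice points `n` of size at most `2N` have their binary phase
`±⟨a+n⟩ ± ⟨n⟩` in a given interval of length two. -/
lemma card_binary_phase_le {A N σ σ' t : ℝ} (hN : 1 ≤ N) (hA : 1 ≤ A) (hσ : σ = -1 ∨ σ = 1)
    (hσ' : σ' = -1 ∨ σ' = 1) {a : Fin 2 → ℤ} (ha : ann A a) {S : Finset (Fin 2 → ℤ)}
    (hS : ∀ n ∈ S, znorm n ≤ 2 * N)
    (ht : ∀ n ∈ S, |σ * jb (a + n) + σ' * jb n - t| ≤ 1) :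
    (S.card : ℝ) ≤ 10060 * N ^ 2 / Real.sqrt (min A N) := by
  have hM : 1 ≤ min A N := le_min hA hN
  set Q := Real.sqrt (min A N) with hQdef
  have hQ : 1 ≤ Q := Real.one_le_sqrt.2 hM
  have hQsq : Q ^ 2 = min A N := Real.sq_sqrt (by linarith)
  have hQN : Q ^ 2 ≤ N := hQsq ▸ min_le_right _ _
  have hQA : Q ^ 2 ≤ A := hQsq ▸ min_le_left _ _
  have hD : 1 ≤ N / Q := by
    rw [le_div_iff₀ (by linarith)]; nlinarith
  have hα : 0 < znorm a := by linarith [ha.1]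
  have hαabs : |znorm a| = znorm a := abs_of_pos hα
  set α := znorm a with hαdef
  set p := (a 0 : ℝ) / α
  set q := (a 1 : ℝ) / α
  have hp : (a 0 : ℝ) = α * p := by simp only [p]; field_simp
  have hq : (a 1 : ℝ) = α * q := by simp only [q]; field_simp
  have hpq : p ^ 2 + q ^ 2 = 1 := by
    have := znorm_sq a
    rw [← hαdef] at this
    simp only [p, q]
    field_simp
    exact this.symm
  have c0 := card_le_of_abs_coordAcross_le (S := S.filter fun n => |coordAcross p q n| ≤ N / Q)
    hpq hN hD (fun n hn => hS n (Finset.mem_filter.1 hn).1)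
    (fun n hn => (Finset.mem_filter.1 hn).2)
  have c1 := card_le_of_lt_coordAcross (S := S.filter fun n => N / Q < coordAcross p q n) (t := t)
    hpq hN hA hQ hQN hQA hσ hσ' hp hq (hαabs.symm ▸ ha.1) (hαabs.symm ▸ ha.2)
    (fun n hn => hS n (Finset.mem_filter.1 hn).1) (fun n hn => ht n (Finset.mem_filter.1 hn).1)
    (fun n hn => (Finset.mem_filter.1 hn).2)
  have c2 := card_le_of_lt_coordAcross
    (S := S.filter fun n => N / Q < coordAcross (-p) (-q) n) (t := t) (α := -α) (a := a)
    (by simpa using hpq) hN hA hQ hQN hQA hσ hσ' (by simpa using hp) (by simpa using hq)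
    (by rw [abs_neg, hαabs]; exact ha.1) (by rw [abs_neg, hαabs]; exact ha.2)
    (fun n hn => hS n (Finset.mem_filter.1 hn).1) (fun n hn => ht n (Finset.mem_filter.1 hn).1)
    (fun n hn => (Finset.mem_filter.1 hn).2)
  have hcover : S ⊆ (S.filter fun n => |coordAcross p q n| ≤ N / Q) ∪
      ((S.filter fun n => N / Q < coordAcross p q n) ∪
        (S.filter fun n => N / Q < coordAcross (-p) (-q) n)) := fun n hn => by
    have hneg : coordAcross (-p) (-q) n = -coordAcross p q n := by
      simp only [coordAcross]; ring
    simp only [Finset.mem_union, Finset.mem_filter, hn, true_and, hneg]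
    rw [← lt_abs]
    exact le_or_gt _ _
  have hcard : (S.card : ℝ) ≤ _ := Nat.cast_le.2 ((Finset.card_le_card hcover).trans
    ((Finset.card_union_le _ _).trans (Nat.add_le_add_left (Finset.card_union_le _ _) _)))
  push_cast at hcard
  calc (S.card : ℝ) ≤ 60 * N * (N / Q) + (5000 * N ^ 2 / Q + 5000 * N ^ 2 / Q) := by linarith
    _ = 10060 * N ^ 2 / Q := by ring

lemma finite_setOf_ann (N : ℝ) : {n : Fin 2 → ℤ | ann N n}.Finite := by
  refine (Set.finite_Icc (fun _ => -⌊2 * N⌋ : Fin 2 → ℤ) (fun _ => ⌊2 * N⌋)).subset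
    fun n hn => ?_
  have key : ∀ i, |(n i : ℝ)| ≤ 2 * N := fun i => by
    refine le_trans (abs_le_of_sq_le_sq ?_ (znorm_nonneg n)) hn.2
    rw [znorm_sq]
    fin_cases i
    · simpa using sq_nonneg (n 1 : ℝ)
    · simpa using sq_nonneg (n 0 : ℝ)
  refine ⟨fun i => ?_, fun i => Int.le_floor.2 (abs_le.1 (key i)).2⟩
  have := Int.le_floor.2 (show ((-n i : ℤ) : ℝ) ≤ 2 * N by
    push_cast; linarith [(abs_le.1 (key i)).1])
  show -⌊2 * N⌋ ≤ n i
  omega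

lemma card_le_of_ann {N : ℝ} (hN : 1 ≤ N) {S : Finset (Fin 2 → ℤ)} (hS : ∀ n ∈ S, ann N n) :
    (S.card : ℝ) ≤ 120 * N ^ 2 := by
  have hv : ∀ n ∈ S, |coordAcross 1 0 n| ≤ 2 * N := fun n hn => by
    refine le_trans (abs_le_of_sq_le_sq ?_ (znorm_nonneg n)) (hS n hn).2
    rw [znorm_sq, coordAcross]
    nlinarith [sq_nonneg (n 0 : ℝ)]
  have := card_le_of_abs_coordAcross_le (p := 1) (q := 0) (by norm_num) hN
    (by linarith : 1 ≤ 2 * N) (fun n hn => (hS n hn).2) hv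
  linarith

/-- A triple count obtained by fixing the two lattice points `f v` and counting `g v`. -/
lemma card_le_of_ann_prod {ι : Type*} {T : Finset ι} {f₁ f₂ g : ι → Fin 2 → ℤ} {A B c : ℝ}
    (hA : 1 ≤ A) (hB : 1 ≤ B) (hc : 0 ≤ c) (h₁ : ∀ v ∈ T, ann A (f₁ v))
    (h₂ : ∀ v ∈ T, ann B (f₂ v))
    (hinj : ∀ v ∈ T, ∀ w ∈ T, f₁ v = f₁ w → f₂ v = f₂ w → g v = g w → v = w)
    (hcount : ∀ v ∈ T,
      (((T.filter fun w => (f₁ w, f₂ w) = (f₁ v, f₂ v)).image g).card : ℝ) ≤ c) :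
    (T.card : ℝ) ≤ c * (120 * A ^ 2 * (120 * B ^ 2)) := by
  refine card_le_mul_of_fiber_le (f := fun v => (f₁ v, f₂ v)) hc (fun v hv => ?_) ?_
  · rw [← Finset.card_image_of_injOn (f := g)]
    · exact hcount v hv
    · intro x hx y hy h
      simp only [Finset.mem_coe, Finset.mem_filter, Prod.mk.injEq] at hx hy
      exact hinj x hx.1 y hy.1 (hx.2.1.trans hy.2.1.symm) (hx.2.2.trans hy.2.2.symm) h
  · have hsub : T.image (fun v => (f₁ v, f₂ v)) ⊆ T.image f₁ ×ˢ T.image f₂ := by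
      intro x hx
      obtain ⟨v, hv, rfl⟩ := Finset.mem_image.1 hx
      exact Finset.mem_product.2
        ⟨Finset.mem_image_of_mem _ hv, Finset.mem_image_of_mem _ hv⟩
    have hcard : ((T.image fun v => (f₁ v, f₂ v)).card : ℝ) ≤
        (T.image f₁).card * (T.image f₂).card := by
      rw [← Nat.cast_mul, ← Finset.card_product]
      exact_mod_cast Finset.card_le_card hsub
    refine hcard.trans ?_
    gcongr
    · exact card_le_of_ann hA fun n hn => by
        obtain ⟨v, hv, rfl⟩ := Finset.mem_image.1 hn
        exact h₁ v hv
    · exact card_le_of_ann hB fun n hn => by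
        obtain ⟨v, hv, rfl⟩ := Finset.mem_image.1 hn
        exact h₂ v hv

lemma eq_of_coord_eq {v w : Fin 3 → Fin 2 → ℤ} (h0 : v 0 = w 0) (h1 : v 1 = w 1)
    (h2 : v 1 + v 2 = w 1 + w 2) : v = w := by
  rw [h1] at h2
  ext i : 1
  fin_cases i
  exacts [h0, h1, add_left_cancel h2]

lemma finite_cubicSetIII (σ σ₂ σ₃ σ₄ N₂ N₃ N₃₄ : ℝ) (m : ℤ) :
    (cubicSetIII σ σ₂ σ₃ σ₄ N₂ N₃ N₃₄ m).Finite := by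
  refine Set.Finite.of_injOn (f := fun v => (v 0, v 1, v 1 + v 2))
    (t := {n | ann N₂ n} ×ˢ {n | ann N₃ n} ×ˢ {n | ann N₃₄ n})
    (fun v hv => ⟨hv.1, hv.2.1, hv.2.2.1⟩) (fun v _ w _ h => ?_)
    ((finite_setOf_ann _).prod ((finite_setOf_ann _).prod (finite_setOf_ann _)))
  simp only [Prod.mk.injEq] at h
  exact eq_of_coord_eq h.1 h.2.1 h.2.2

/-- cubic counting estimate (iii): there is a universal `C > 0` such that for all
signs, dyadic `N₂, N₃, N₃₄` and every `m ∈ ℤ`, the cardinality of the above set is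
`≤ C (N₂N₃N₃₄)² / min(N₃₄, max(N₂,N₃))^{1/2}`. -/
theorem cubic_counting_iii :
    ∃ C : ℝ, 0 < C ∧
      ∀ (σ σ₂ σ₃ σ₄ : ℝ), (σ = -1 ∨ σ = 1) → (σ₂ = -1 ∨ σ₂ = 1) →
        (σ₃ = -1 ∨ σ₃ = 1) → (σ₄ = -1 ∨ σ₄ = 1) →
        ∀ (k₂ k₃ k₃₄ : ℕ) (m : ℤ),
          (cubicSetIII σ σ₂ σ₃ σ₄ ((2:ℝ)^k₂) ((2:ℝ)^k₃) ((2:ℝ)^k₃₄) m).Finite ∧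
          ((cubicSetIII σ σ₂ σ₃ σ₄ ((2:ℝ)^k₂) ((2:ℝ)^k₃) ((2:ℝ)^k₃₄) m).ncard : ℝ) ≤
            C * ((2:ℝ)^k₂ * (2:ℝ)^k₃ * (2:ℝ)^k₃₄) ^ 2 /
              Real.sqrt (min ((2:ℝ)^k₃₄) (max ((2:ℝ)^k₂) ((2:ℝ)^k₃))) := by
  refine ⟨10060 * 14400, by norm_num, ?_⟩
  intro σ σ₂ σ₃ σ₄ hσ hσ₂ hσ₃ hσ₄ k₂ k₃ k₃₄ m
  have hfin := finite_cubicSetIII σ σ₂ σ₃ σ₄ ((2:ℝ)^k₂) ((2:ℝ)^k₃) ((2:ℝ)^k₃₄) m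
  refine ⟨hfin, ?_⟩
  have h2 : (1 : ℝ) ≤ 2 ^ k₂ := one_le_pow₀ one_le_two
  have h3 : (1 : ℝ) ≤ 2 ^ k₃ := one_le_pow₀ one_le_two
  have h34 : (1 : ℝ) ≤ 2 ^ k₃₄ := one_le_pow₀ one_le_two
  generalize (2 : ℝ) ^ k₂ = N₂ at *
  generalize (2 : ℝ) ^ k₃ = N₃ at *
  generalize (2 : ℝ) ^ k₃₄ = N₃₄ at *
  rw [Set.ncard_eq_toFinset_card _ hfin]
  have hT : ∀ v ∈ hfin.toFinset, ann N₂ (v 0) ∧ ann N₃ (v 1) ∧ ann N₃₄ (v 1 + v 2) ∧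
      |phase σ σ₂ σ₃ σ₄ (v 0) (v 1) (v 2) - (m : ℝ)| ≤ 1 := fun v hv =>
    hfin.mem_toFinset.1 hv
  rcases le_total N₃ N₂ with h | h
  · rw [max_eq_left h]
    have key := card_le_of_ann_prod (T := hfin.toFinset) (f₁ := fun v => v 1 + v 2)
      (f₂ := fun v => v 1) (g := fun v => v 0) (c := 10060 * N₂ ^ 2 / Real.sqrt (min N₃₄ N₂))
      h34 h3 (by positivity) (fun v hv => (hT v hv).2.2.1) (fun v hv => (hT v hv).2.1)
      (fun v _ w _ e₁ e₂ e₃ => eq_of_coord_eq e₃ e₂ e₁) (fun v hv =>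
        card_binary_phase_le h2 h34 hσ hσ₂ (hT v hv).2.2.1
          (t := m - σ₃ * jb (v 1) - σ₄ * jb (v 2)) (fun n hn => by
            obtain ⟨w, hw, rfl⟩ := Finset.mem_image.1 hn
            exact (hT w (Finset.mem_filter.1 hw).1).1.2) (fun n hn => by
            obtain ⟨w, hw, rfl⟩ := Finset.mem_image.1 hn
            obtain ⟨hw, he⟩ := Finset.mem_filter.1 hw
            simp only [Prod.mk.injEq] at he
            have e2 : w 2 = v 2 := add_left_cancel (he.2 ▸ he.1)
            have := (hT w hw).2.2.2
            rw [phase, he.2, e2, add_assoc (w 0), add_comm (w 0)] at this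
            convert this using 2
            ring))
    refine key.trans_eq ?_
    ring
  · rw [max_eq_right h]
    have key := card_le_of_ann_prod (T := hfin.toFinset) (f₁ := fun v => v 1 + v 2)
      (f₂ := fun v => v 0) (g := fun v => v 1) (c := 10060 * N₃ ^ 2 / Real.sqrt (min N₃₄ N₃))
      h34 h2 (by positivity) (fun v hv => (hT v hv).2.2.1) (fun v hv => (hT v hv).1)
      (fun v _ w _ e₁ e₂ e₃ => eq_of_coord_eq e₂ e₃ e₁) (fun v hv =>
        card_binary_phase_le (a := -(v 1 + v 2)) h3 h34 hσ₄ hσ₃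
          (by simpa only [ann, znorm_neg] using (hT v hv).2.2.1)
          (t := m - σ * jb (v 0 + (v 1 + v 2)) - σ₂ * jb (v 0)) (fun n hn => by
            obtain ⟨w, hw, rfl⟩ := Finset.mem_image.1 hn
            exact (hT w (Finset.mem_filter.1 hw).1).2.1.2) (fun n hn => by
            obtain ⟨w, hw, rfl⟩ := Finset.mem_image.1 hn
            obtain ⟨hw, he⟩ := Finset.mem_filter.1 hw
            simp only [Prod.mk.injEq] at he
            have e2 : -(v 1 + v 2) + w 1 = -w 2 := by rw [← he.1]; abel
            have := (hT w hw).2.2.2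
            rw [phase, add_assoc (w 0), he.1, he.2] at this
            rw [e2, jb_neg]
            convert this using 2
            ring))
    refine key.trans_eq ?_
    ring
end

section
/- There exists a universal constant C > 0 with the following property: for all signs σ, σ₁, σ₂, σ₃ ∈ {−1, 1}, all dyadic numbers N₁, N₂, N₃, every m ∈ ℤ and every n ∈ ℤ², the cardinality of the set { (n₁, n₂, n₃) ∈ (ℤ²)³ : |n_j| ∼ N_j for j = 1, 2, 3, n₁+n₂+n₃ = n and |φ(n₁,n₂,n₃) − m| ≤ 1 } is at most C · med(N₁, N₂, N₃)² · min(N₁, N₂, N₃)^{3/2}. -/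
/-- The counting set of the cubic sup-counting estimate (convolution form): triples with
`|n_j| ∼ N_j`, `n₁+n₂+n₃ = n` and `|φ − m| ≤ 1`. -/
def cubicSupSet (σ σ₁ σ₂ σ₃ N₁ N₂ N₃ : ℝ) (n : Fin 2 → ℤ) (m : ℤ) :
    Set (Fin 3 → Fin 2 → ℤ) :=
  {v | ann N₁ (v 0) ∧ ann N₂ (v 1) ∧ ann N₃ (v 2) ∧ v 0 + v 1 + v 2 = n ∧
    |phase σ σ₁ σ₂ σ₃ (v 0) (v 1) (v 2) - (m : ℝ)| ≤ 1}

lemma le_of_sq_le {a b : ℝ} (h : a ^ 2 ≤ b ^ 2) (hb : 0 ≤ b) : a ≤ b :=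
  le_of_not_gt fun hab => by nlinarith

/-- Japanese bracket of the lattice point `(a, b)`. -/
noncomputable def bracket (a b : ℤ) : ℝ := √(1 + (a : ℝ) ^ 2 + (b : ℝ) ^ 2)

lemma bracket_pos (a b : ℤ) : 0 < bracket a b := Real.sqrt_pos.2 (by positivity)

lemma bracket_sq (a b : ℤ) : bracket a b ^ 2 = 1 + (a : ℝ) ^ 2 + (b : ℝ) ^ 2 :=
  Real.sq_sqrt (by positivity)

lemma bracket_comm (a b : ℤ) : bracket a b = bracket b a := by
  unfold bracket; congr 1; ring

lemma bracket_sub_le (a s t : ℤ) : |bracket a t - bracket a s| ≤ |(t : ℝ) - s| := by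
  have hr := bracket_pos a t
  have hq := bracket_pos a s
  have hr2 := bracket_sq a t
  have hq2 := bracket_sq a s
  rw [← sq_le_sq]
  have h1 : 1 + (a : ℝ) ^ 2 + s * t ≤ bracket a t * bracket a s := by
    refine le_of_sq_le ?_ (by positivity)
    rw [mul_pow, hr2, hq2]
    nlinarith [mul_nonneg (show (0 : ℝ) ≤ 1 + (a : ℝ) ^ 2 by positivity)
      (sq_nonneg ((t : ℝ) - s))]
  nlinarith

/-- Quantitative convexity of the bracket along a line. -/
lemma bracket_strong_convex {R : ℝ} (a s t : ℤ) (ht : bracket a t ≤ R) (hs : bracket a s ≤ R) :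
    bracket a s + s / bracket a s * (t - s) + (a : ℝ) ^ 2 / (2 * R ^ 3) * (t - s) ^ 2 ≤
      bracket a t := by
  have hr := bracket_pos a t
  have hq := bracket_pos a s
  have hr2 := bracket_sq a t
  have hq2 := bracket_sq a s
  have hR : 0 < R := hr.trans_le ht
  set r := bracket a t
  set q := bracket a s
  set w : ℝ := 1 + (a : ℝ) ^ 2 + s * t with hw
  have hrq : (r * q) ^ 2 = w ^ 2 + (1 + (a : ℝ) ^ 2) * (t - s) ^ 2 := by
    rw [mul_pow, hr2, hq2, hw]; ring
  have h1 : w ≤ r * q := by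
    refine le_of_sq_le ?_ (by positivity)
    rw [hrq]
    nlinarith [mul_nonneg (show (0 : ℝ) ≤ 1 + (a : ℝ) ^ 2 by positivity)
      (sq_nonneg ((t : ℝ) - s))]
  have h2 : (a : ℝ) ^ 2 * (t - s) ^ 2 ≤ (r * q - w) * (2 * (r * q)) := by
    nlinarith [sq_nonneg ((t : ℝ) - s), mul_nonneg (sub_nonneg.2 h1) (sub_nonneg.2 h1)]
  have h3 : r - (q + s / q * (t - s)) = (r * q - w) / q := by
    field_simp
    rw [hw]; linarith
  have h4 : (a : ℝ) ^ 2 / (2 * R ^ 3) * (t - s) ^ 2 ≤ (r * q - w) / q := by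
    rw [div_mul_eq_mul_div, div_le_div_iff₀ (by positivity) hq]
    have h5 : r * q * q ≤ R ^ 3 := by
      calc r * q * q ≤ R * R * R := by gcongr
        _ = R ^ 3 := by ring
    calc (a : ℝ) ^ 2 * (t - s) ^ 2 * q ≤ (r * q - w) * (2 * (r * q)) * q := by gcongr
      _ = (r * q - w) * (2 * (r * q * q)) := by ring
      _ ≤ (r * q - w) * (2 * R ^ 3) := by
        apply mul_le_mul_of_nonneg_left _ (sub_nonneg.2 h1)
        linarith
  linarith

/-- A finite set of integers each of whose points is close to every point on its left or
close to every point on its right has few elements. -/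
lemma card_le_of_close {S : Finset ℤ} {d : ℝ} (hd : 0 ≤ d)
    (h : ∀ r ∈ S, ∀ s ∈ S, ∀ t ∈ S, r ≤ s → s ≤ t → (s : ℝ) - r ≤ d ∨ (t : ℝ) - s ≤ d) :
    (S.card : ℝ) ≤ 2 * d + 2 := by
  rcases S.eq_empty_or_nonempty with rfl | hS
  · simp; linarith
  set p := S.min' hS
  set q := S.max' hS
  have hsub : S ⊆ Finset.Icc p (p + ⌊d⌋) ∪ Finset.Icc (q - ⌊d⌋) q := by
    intro s hs
    have h1 := S.min'_le s hs
    have h2 := S.le_max' s hs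
    rw [Finset.mem_union, Finset.mem_Icc, Finset.mem_Icc]
    rcases h p (S.min'_mem hS) s hs q (S.max'_mem hS) h1 h2 with h3 | h3
    · left
      have : s - p ≤ ⌊d⌋ := Int.le_floor.2 (by push_cast; exact h3)
      exact ⟨h1, by linarith⟩
    · right
      have : q - s ≤ ⌊d⌋ := Int.le_floor.2 (by push_cast; exact h3)
      exact ⟨by linarith, h2⟩
  have hf : 0 ≤ ⌊d⌋ := Int.floor_nonneg.2 hd
  have hc : ((S.card : ℕ) : ℤ) ≤ 2 * ⌊d⌋ + 2 := by
    have h1 := (Finset.card_le_card hsub).trans (Finset.card_union_le _ _)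
    rw [Int.card_Icc, Int.card_Icc] at h1
    omega
  have hc' : (S.card : ℝ) ≤ 2 * (⌊d⌋ : ℝ) + 2 := by exact_mod_cast hc
  linarith [Int.floor_le d]

/-- On a level set of `x ↦ ⟨x⟩ ± ⟨l - x⟩`, the function `μ⟨x⟩ - l·x` is nearly constant. -/
lemma linearized_phase {ε μ L N : ℝ} (hε : ε = -1 ∨ ε = 1) (hN : 1 ≤ N) {l₀ l₁ a b : ℤ}
    (h₀ : |(l₀ : ℝ)| ≤ L) (h₁ : |(l₁ : ℝ)| ≤ L) (hab : (a : ℝ) ^ 2 + (b : ℝ) ^ 2 ≤ 4 * N ^ 2)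
    (h : |bracket a b + ε * bracket (l₀ - a) (l₁ - b) - μ| ≤ 1) :
    |μ * bracket a b - l₀ * a - l₁ * b - (μ ^ 2 - l₀ ^ 2 - l₁ ^ 2) / 2| ≤ 4 * N + 2 * L := by
  have hr := bracket_pos a b
  have hr2 := bracket_sq a b
  have hq := bracket_pos (l₀ - a) (l₁ - b)
  have hq2 := bracket_sq (l₀ - a) (l₁ - b)
  have hL : 0 ≤ L := (abs_nonneg _).trans h₀
  push_cast at hq2
  set r := bracket a b
  set q := bracket (l₀ - a) (l₁ - b)
  have hε2 : ε ^ 2 = 1 := by rcases hε with rfl | rfl <;> norm_num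
  have h0' : (l₀ : ℝ) ^ 2 ≤ L ^ 2 := sq_le_sq' (abs_le.1 h₀).1 (abs_le.1 h₀).2
  have h1' : (l₁ : ℝ) ^ 2 ≤ L ^ 2 := sq_le_sq' (abs_le.1 h₁).1 (abs_le.1 h₁).2
  have hqle : q ≤ 3 * N + 2 * L := by
    refine le_of_sq_le ?_ (by positivity)
    have hcs : -(l₀ * a + l₁ * b : ℝ) ≤ 2 * L * (2 * N) := by
      refine le_of_sq_le ?_ (by positivity)
      calc (-(l₀ * a + l₁ * b : ℝ)) ^ 2
          ≤ ((l₀ : ℝ) ^ 2 + l₁ ^ 2) * ((a : ℝ) ^ 2 + b ^ 2) := by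
            nlinarith [sq_nonneg ((l₀ : ℝ) * b - l₁ * a)]
        _ ≤ (4 * L ^ 2) * (4 * N ^ 2) := by gcongr; nlinarith
        _ = _ := by ring
    nlinarith [mul_nonneg hL (zero_le_one.trans hN)]
  obtain ⟨δ, hδ⟩ : ∃ δ, δ = μ - (r + ε * q) := ⟨_, rfl⟩
  have hδ1 : |δ| ≤ 1 := by rw [hδ, abs_sub_comm]; exact h
  have key : μ * r - l₀ * a - l₁ * b - (μ ^ 2 - l₀ ^ 2 - l₁ ^ 2) / 2
      = -(δ * ε * q) - δ ^ 2 / 2 := by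
    have hμ : μ = δ + r + ε * q := by rw [hδ]; ring
    rw [hμ]
    linear_combination (1 / 2) * hr2 - (1 / 2) * hq2 - q ^ 2 / 2 * hε2
  rw [key]
  have h2 : |δ * ε * q| ≤ q := by
    rw [abs_mul, abs_mul, abs_of_pos hq]
    have : |ε| = 1 := by rcases hε with rfl | rfl <;> norm_num
    rw [this]; nlinarith
  have h3 : δ ^ 2 ≤ 1 := by rw [← sq_abs]; nlinarith [abs_nonneg δ]
  rw [abs_le] at h2 ⊢
  constructor <;> nlinarith [sq_nonneg δ]

/-- Number of points of a level set of `x ↦ ⟨x⟩ ± ⟨l - x⟩` on a line parallel to an axis. -/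
lemma fiber_card_le {ε μ L N : ℝ} (hε : ε = -1 ∨ ε = 1) (hN : 1 ≤ N) (hL : 1 ≤ L) {l₀ l₁ a : ℤ}
    (h₀ : |(l₀ : ℝ)| ≤ L) (h₁ : |(l₁ : ℝ)| ≤ L) {S : Finset ℤ}
    (hS : ∀ b ∈ S, (a : ℝ) ^ 2 + (b : ℝ) ^ 2 ≤ 4 * N ^ 2 ∧
      |bracket a b + ε * bracket (l₀ - a) (l₁ - b) - μ| ≤ 1)
    (hcase : (N / 4 ≤ |(a : ℝ)| ∧ L / 2 ≤ |μ|) ∨ (|(l₁ : ℝ)| = L ∧ |μ| ≤ L / 2)) :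
    (S.card : ℝ) ≤ 236 * (N / √L) + 170 * √N := by
  set d : ℝ := 118 * (N / √L) + 84 * √N with hd
  have hsN : 1 ≤ √N := Real.one_le_sqrt.2 hN
  have hsL : 1 ≤ √L := Real.one_le_sqrt.2 hL
  have hd0 : 0 ≤ d := by positivity
  suffices (S.card : ℝ) ≤ 2 * d + 2 by rw [hd] at this; linarith
  have hlin := fun b (hb : b ∈ S) => linearized_phase hε hN h₀ h₁ (hS b hb).1 (hS b hb).2
  have hdiff : ∀ s ∈ S, ∀ t ∈ S,
      |μ * (bracket a t - bracket a s) - l₁ * (t - s)| ≤ 8 * N + 4 * L := by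
    intro s hs t ht
    have h1 := abs_le.1 (hlin s hs)
    have h2 := abs_le.1 (hlin t ht)
    rw [abs_le]
    constructor <;> nlinarith
  have hNL : 0 ≤ N / √L := by positivity
  apply card_le_of_close hd0
  intro p hp s hs t ht hps hst
  have hps' : (0 : ℝ) ≤ s - p := sub_nonneg.2 (by exact_mod_cast hps)
  have hst' : (0 : ℝ) ≤ t - s := sub_nonneg.2 (by exact_mod_cast hst)
  rcases hcase with ⟨ha, hμ⟩ | ⟨hl, hμ⟩
  · have hR : ∀ b ∈ S, bracket a b ≤ 3 * N := by
      intro b hb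
      refine le_of_sq_le ?_ (by positivity)
      rw [bracket_sq]
      nlinarith [(hS b hb).1]
    have hd2 : 1728 * N * (8 * N + 4 * L) ≤ L * d ^ 2 := by
      have e1 : L * (N / √L) ^ 2 = N ^ 2 := by
        rw [div_pow, Real.sq_sqrt (by positivity)]; field_simp
      have e2 : √N ^ 2 = N := Real.sq_sqrt (by positivity)
      have e3 : 118 ^ 2 * (N / √L) ^ 2 + 84 ^ 2 * √N ^ 2 ≤ d ^ 2 := by
        rw [hd]; nlinarith [mul_nonneg hNL (zero_le_one.trans hsN)]
      have e4 := mul_le_mul_of_nonneg_left e3 (zero_le_one.trans hL)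
      have e5 : 0 ≤ N * L := by positivity
      rw [mul_add, mul_left_comm, e1, e2] at e4
      nlinarith [sq_nonneg N]
    have close : ∀ x : ℝ, 0 ≤ x → |μ| * (1 / (864 * N) * x ^ 2) ≤ 8 * N + 4 * L → x ≤ d := by
      intro x hx h
      refine le_of_sq_le ?_ hd0
      have h1 : L / 2 * (1 / (864 * N) * x ^ 2) ≤ 8 * N + 4 * L :=
        (mul_le_mul_of_nonneg_right hμ (by positivity)).trans h
      have h2 : L * x ^ 2 ≤ 1728 * N * (8 * N + 4 * L) := by
        have : L / 2 * (1 / (864 * N) * x ^ 2) = L * x ^ 2 / (1728 * N) := by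
          field_simp; ring
        rw [this, div_le_iff₀ (by positivity)] at h1
        linarith
      exact le_of_mul_le_mul_left (h2.trans hd2) (by positivity)
    have hk : 1 / (864 * N) ≤ (a : ℝ) ^ 2 / (2 * (3 * N) ^ 3) := by
      rw [div_le_div_iff₀ (by positivity) (by positivity)]
      have : (N / 4) ^ 2 ≤ (a : ℝ) ^ 2 := by
        rw [← sq_abs (a : ℝ)]; gcongr
      have hN0 : 0 ≤ N := by linarith
      nlinarith [mul_le_mul_of_nonneg_left this hN0]
    have conv : ∀ u ∈ S, s / bracket a s * (u - s) + 1 / (864 * N) * ((u : ℝ) - s) ^ 2 ≤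
        bracket a u - bracket a s := by
      intro u hu
      have h1 := bracket_strong_convex a s u (hR u hu) (hR s hs)
      have h2 := mul_le_mul_of_nonneg_right hk (sq_nonneg ((u : ℝ) - s))
      linarith
    have ht1 := conv t ht
    have hp1 := conv p hp
    have ht2 := abs_le.1 (hdiff s hs t ht)
    have hp2 := abs_le.1 (hdiff s hs p hp)
    set g : ℝ := s / bracket a s
    rcases le_total 0 μ with hμ0 | hμ0
    · rw [abs_of_nonneg hμ0] at close
      have ht3 := mul_le_mul_of_nonneg_left ht1 hμ0
      have hp3 := mul_le_mul_of_nonneg_left hp1 hμ0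
      rcases le_total 0 (μ * g - l₁) with hs' | hs'
      · right
        apply close _ hst'
        linarith [mul_nonneg hs' hst']
      · left
        apply close _ hps'
        linarith [mul_nonneg (neg_nonneg.2 hs') hps']
    · rw [abs_of_nonpos hμ0] at close
      have ht3 := mul_le_mul_of_nonneg_left ht1 (neg_nonneg.2 hμ0)
      have hp3 := mul_le_mul_of_nonneg_left hp1 (neg_nonneg.2 hμ0)
      rcases le_total 0 (-μ * g + l₁) with hs' | hs'
      · right
        apply close _ hst'
        linarith [mul_nonneg hs' hst']
      · left
        apply close _ hps'
        linarith [mul_nonneg (neg_nonneg.2 hs') hps']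
  · right
    have h1 : L * (t - s) ≤ 8 * N + 4 * L + L / 2 * (t - s) := by
      have e1 : |(l₁ : ℝ) * (t - s)| = L * (t - s) := by rw [abs_mul, hl, abs_of_nonneg hst']
      have e2 : |μ * (bracket a t - bracket a s)| ≤ L / 2 * (t - s) := by
        rw [abs_mul]
        have := bracket_sub_le a s t
        rw [abs_of_nonneg hst'] at this
        gcongr
      have e3 := abs_sub_abs_le_abs_sub ((l₁ : ℝ) * (t - s)) (μ * (bracket a t - bracket a s))
      rw [abs_sub_comm] at e3
      linarith [hdiff s hs t ht]
    have h2 : (t : ℝ) - s ≤ 16 * (N / L) + 8 := by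
      have : L * (t - s) ≤ L * (16 * (N / L) + 8) := by
        have : L * (16 * (N / L) + 8) = 16 * N + 8 * L := by field_simp
        rw [this]; linarith
      exact le_of_mul_le_mul_left this (by positivity)
    have h3 : N / L ≤ N / √L := by
      gcongr
      exact Real.sqrt_le_self_iff.2 (Or.inr hL)
    rw [hd]; linarith

/-- The box of lattice points containing the ball of radius `2N`. -/
noncomputable def box (N : ℕ) : Finset ℤ := Finset.Icc (-(2 * N : ℤ)) (2 * N)

lemma box_card_le {N : ℕ} (hN : 1 ≤ N) : ((box N).card : ℝ) ≤ 5 * N := by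
  have h : ((box N).card : ℤ) ≤ 5 * N := by
    rw [box, Int.card_Icc]; omega
  exact_mod_cast h

lemma mem_box_of_sq_le {N : ℕ} {a : ℤ} (h : (a : ℝ) ^ 2 ≤ 4 * (N : ℝ) ^ 2) : a ∈ box N := by
  have h' : a ^ 2 ≤ (2 * N : ℤ) ^ 2 := by
    have : (a : ℝ) ^ 2 ≤ (2 * N : ℝ) ^ 2 := by rw [mul_pow]; linarith
    exact_mod_cast this
  rw [box, Finset.mem_Icc]
  exact abs_le.1 (abs_le_of_sq_le_sq h' (by positivity))

lemma card_le_of_fiber_card_le {α β : Type*} [DecidableEq α] [DecidableEq β]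
    {A : Finset (α × β)} {I : Finset α} {K : ℝ}
    (hI : ∀ p ∈ A, p.1 ∈ I)
    (hK : ∀ a ∈ I, ((((A.filter fun p => p.1 = a).image Prod.snd).card : ℕ) : ℝ) ≤ K) :
    (A.card : ℝ) ≤ I.card * K := by
  rw [Finset.card_eq_sum_card_fiberwise hI]
  push_cast
  rw [← nsmul_eq_mul]
  apply Finset.sum_le_card_nsmul
  intro a ha
  rw [← Finset.card_image_of_injOn (f := Prod.snd)]
  · exact hK a ha
  · intro p hp q hq hpq
    simp only [Finset.coe_filter, Set.mem_ofPred_eq] at hp hq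
    exact Prod.ext (hp.2.trans hq.2.symm) hpq

/-- Level sets of `x ↦ ⟨x⟩ ± ⟨l - x⟩` that are well behaved on vertical lines. -/
lemma level_card_le_of_vertical {ε μ L : ℝ} {N : ℕ} (hε : ε = -1 ∨ ε = 1) (hN : 1 ≤ N)
    (hL : 1 ≤ L) {l₀ l₁ : ℤ} (h₀ : |(l₀ : ℝ)| ≤ L) (h₁ : |(l₁ : ℝ)| ≤ L) {A : Finset (ℤ × ℤ)}
    (hA : ∀ p ∈ A, (p.1 : ℝ) ^ 2 + (p.2 : ℝ) ^ 2 ≤ 4 * (N : ℝ) ^ 2 ∧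
      |bracket p.1 p.2 + ε * bracket (l₀ - p.1) (l₁ - p.2) - μ| ≤ 1)
    (hcase : ∀ p ∈ A, ((N : ℝ) / 4 ≤ |(p.1 : ℝ)| ∧ L / 2 ≤ |μ|) ∨
      (|(l₁ : ℝ)| = L ∧ |μ| ≤ L / 2)) :
    (A.card : ℝ) ≤ 5 * N * (236 * (N / √L) + 170 * √N) := by
  have hN' : (1 : ℝ) ≤ N := by exact_mod_cast hN
  refine (card_le_of_fiber_card_le (I := box N) (K := 236 * (N / √L) + 170 * √N)
    (fun p hp => mem_box_of_sq_le (by nlinarith [(hA p hp).1])) ?_).trans ?_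
  · intro a _
    rcases (A.filter fun p => p.1 = a).eq_empty_or_nonempty with he | ⟨p, hp⟩
    · rw [he]; simp; positivity
    · rw [Finset.mem_filter] at hp
      refine fiber_card_le (a := a) hε hN' hL h₀ h₁ ?_ (hp.2 ▸ hcase p hp.1)
      intro b hb
      obtain ⟨q, hq, rfl⟩ := Finset.mem_image.1 hb
      rw [Finset.mem_filter] at hq
      exact hq.2 ▸ hA q hq.1
  · gcongr
    exact box_card_le hN

/-- Level sets of `x ↦ ⟨x⟩ ± ⟨l - x⟩` in an annulus. -/
lemma level_card_le {ε μ : ℝ} {N : ℕ} (hε : ε = -1 ∨ ε = 1) (hN : 1 ≤ N) (l₀ l₁ : ℤ)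
    {A : Finset (ℤ × ℤ)}
    (hA : ∀ p ∈ A, (N : ℝ) ^ 2 / 4 ≤ (p.1 : ℝ) ^ 2 + (p.2 : ℝ) ^ 2 ∧
      (p.1 : ℝ) ^ 2 + (p.2 : ℝ) ^ 2 ≤ 4 * (N : ℝ) ^ 2 ∧
      |bracket p.1 p.2 + ε * bracket (l₀ - p.1) (l₁ - p.2) - μ| ≤ 1) :
    (A.card : ℝ) ≤ 2360 * (N ^ 2 / √(max 1 |(l₀ : ℝ)|) + N * √N) := by
  have hN' : (1 : ℝ) ≤ N := by exact_mod_cast hN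
  set L : ℝ := max |(l₀ : ℝ)| |(l₁ : ℝ)| with hLdef
  have h₀ : |(l₀ : ℝ)| ≤ L := le_max_left _ _
  have h₁ : |(l₁ : ℝ)| ≤ L := le_max_right _ _
  rcases lt_or_ge L 1 with hL | hL
  · rw [max_eq_left (h₀.trans hL.le), Real.sqrt_one, div_one]
    have hsub : A ⊆ box N ×ˢ box N := by
      intro p hp
      rw [Finset.mem_product]
      have := (hA p hp).2.1
      exact ⟨mem_box_of_sq_le (by nlinarith), mem_box_of_sq_le (by nlinarith)⟩
    have h1 : (A.card : ℝ) ≤ (box N).card * (box N).card := by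
      have := Finset.card_le_card hsub
      rw [Finset.card_product] at this
      exact_mod_cast this
    have h2 : ((box N).card : ℝ) * (box N).card ≤ 5 * N * (5 * N) := by
      gcongr <;> exact box_card_le hN
    have h3 : (0 : ℝ) ≤ N * √N := by positivity
    nlinarith
  have hmono : (N : ℝ) / √L ≤ N / √(max 1 |(l₀ : ℝ)|) := by
    gcongr
    exact max_le hL h₀
  have hfin : 2 * (5 * (N : ℝ) * (236 * (N / √L) + 170 * √N)) ≤
      2360 * (N ^ 2 / √(max 1 |(l₀ : ℝ)|) + N * √N) := by
    have h1 := mul_le_mul_of_nonneg_left hmono (zero_le_one.trans hN')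
    have h2 : (N : ℝ) ^ 2 / √(max 1 |(l₀ : ℝ)|) = N * (N / √(max 1 |(l₀ : ℝ)|)) := by ring
    have h3 : (0 : ℝ) ≤ N * √N := by positivity
    rw [h2]; nlinarith
  refine le_trans ?_ hfin
  have hpos : 0 ≤ 5 * (N : ℝ) * (236 * (N / √L) + 170 * √N) := by positivity
  have swapped : ∀ B ⊆ A, (∀ p ∈ B, ((N : ℝ) / 4 ≤ |(p.2 : ℝ)| ∧ L / 2 ≤ |μ|) ∨
      (|(l₀ : ℝ)| = L ∧ |μ| ≤ L / 2)) →
      (B.card : ℝ) ≤ 5 * N * (236 * (N / √L) + 170 * √N) := by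
    intro B hB hc
    rw [← Finset.card_map (Equiv.prodComm ℤ ℤ).toEmbedding]
    refine level_card_le_of_vertical (μ := μ) hε hN hL h₁ h₀ ?_ ?_
    · intro p hp
      obtain ⟨q, hq, rfl⟩ := Finset.mem_map.1 hp
      have := (hA q (hB hq)).2
      refine ⟨?_, ?_⟩
      · simpa [add_comm] using this.1
      · simpa [bracket_comm] using this.2
    · intro p hp
      obtain ⟨q, hq, rfl⟩ := Finset.mem_map.1 hp
      exact hc q hq
  have vertical : ∀ B ⊆ A, (∀ p ∈ B, ((N : ℝ) / 4 ≤ |(p.1 : ℝ)| ∧ L / 2 ≤ |μ|) ∨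
      (|(l₁ : ℝ)| = L ∧ |μ| ≤ L / 2)) →
      (B.card : ℝ) ≤ 5 * N * (236 * (N / √L) + 170 * √N) := fun B hB hc =>
    level_card_le_of_vertical hε hN hL h₀ h₁ (fun p hp => (hA p (hB hp)).2) hc
  rcases le_total (L / 2) |μ| with hμ | hμ
  · have h1 := vertical (A.filter fun p => (N : ℝ) / 4 ≤ |(p.1 : ℝ)|)
      (Finset.filter_subset _ _) (fun p hp => Or.inl ⟨(Finset.mem_filter.1 hp).2, hμ⟩)
    have h2 := swapped (A.filter fun p => ¬ (N : ℝ) / 4 ≤ |(p.1 : ℝ)|)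
      (Finset.filter_subset _ _) (by
        intro p hp
        rw [Finset.mem_filter, not_le] at hp
        refine Or.inl ⟨?_, hμ⟩
        have h3 := (hA p hp.1).1
        have h4 : (p.1 : ℝ) ^ 2 ≤ (N / 4) ^ 2 := by
          rw [← sq_abs]
          have := hp.2.le
          gcongr
        refine le_of_sq_le ?_ (abs_nonneg _)
        rw [sq_abs]
        nlinarith)
    have h3 := Finset.card_filter_add_card_filter_not (s := A)
      (fun p => (N : ℝ) / 4 ≤ |(p.1 : ℝ)|)
    have h4 : (A.card : ℝ) = (A.filter fun p => (N : ℝ) / 4 ≤ |(p.1 : ℝ)|).card +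
      (A.filter fun p => ¬ (N : ℝ) / 4 ≤ |(p.1 : ℝ)|).card := by exact_mod_cast h3.symm
    linarith
  · rcases max_choice |(l₀ : ℝ)| |(l₁ : ℝ)| with h | h
    · linarith [swapped A subset_rfl fun p _ => Or.inr ⟨h.symm, hμ⟩]
    · linarith [vertical A subset_rfl fun p _ => Or.inr ⟨h.symm, hμ⟩]

lemma sum_inv_sqrt_le (M : ℕ) : ∑ i ∈ Finset.range M, 1 / √((i : ℝ) + 1) ≤ 2 * √M := by
  induction M with
  | zero => simp
  | succ k ih =>
    rw [Finset.sum_range_succ]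
    push_cast
    have hp : 0 < √((k : ℝ) + 1) := Real.sqrt_pos.2 (by positivity)
    have h1 : √((k : ℝ) + 1) ^ 2 = k + 1 := Real.sq_sqrt (by positivity)
    have h2 : √(k : ℝ) ^ 2 = k := Real.sq_sqrt (by positivity)
    have h3 : 1 / √((k : ℝ) + 1) ≤ 2 * (√((k : ℝ) + 1) - √k) := by
      rw [div_le_iff₀ hp]
      nlinarith [sq_nonneg (√((k : ℝ) + 1) - √k)]
    linarith

lemma sum_box_inv_sqrt_le {M : ℕ} (hM : 1 ≤ M) (n : ℤ) :
    ∑ j ∈ box M, 1 / √(max 1 |((n - j : ℤ) : ℝ)|) ≤ 10 * √M := by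
  have hM' : (1 : ℝ) ≤ M := by exact_mod_cast hM
  have hs : 1 ≤ √(M : ℝ) := Real.one_le_sqrt.2 hM'
  set f : ℤ → ℝ := fun i => 1 / √(max 1 |(i : ℝ)|) with hf
  have hf0 : ∀ i, 0 ≤ f i := fun i => by positivity
  have hfar : ∑ j ∈ (box M).filter (fun j => ¬ |n - j| ≤ (M : ℤ)), f (n - j) ≤ 5 * √M := by
    calc ∑ j ∈ (box M).filter (fun j => ¬ |n - j| ≤ (M : ℤ)), f (n - j)
        ≤ ((box M).filter (fun j => ¬ |n - j| ≤ (M : ℤ))).card • (1 / √(M : ℝ)) := by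
          apply Finset.sum_le_card_nsmul
          intro j hj
          have h1 := (Finset.mem_filter.1 hj).2
          have h2 : (M : ℝ) ≤ |((n - j : ℤ) : ℝ)| := by exact_mod_cast (not_le.1 h1).le
          rw [hf]
          dsimp only
          gcongr
          exact h2.trans (le_max_right _ _)
      _ ≤ (5 * M) * (1 / √(M : ℝ)) := by
          rw [nsmul_eq_mul]
          gcongr
          refine le_trans ?_ (box_card_le hM)
          exact_mod_cast Finset.card_filter_le _ _
      _ = 5 * √M := by
          rw [mul_one_div, mul_div_assoc, Real.div_sqrt]
  have hnear : ∑ j ∈ (box M).filter (fun j => |n - j| ≤ (M : ℤ)), f (n - j) ≤ 5 * √M := by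
    have hinj : Set.InjOn (fun j : ℤ => n - j)
        ((box M).filter (fun j => |n - j| ≤ (M : ℤ)) : Finset ℤ) := fun a _ b _ h => by
      dsimp only at h; omega
    rw [← Finset.sum_image (f := f) hinj]
    have hsub : ((box M).filter (fun j => |n - j| ≤ (M : ℤ))).image (fun j => n - j) ⊆
        {0} ∪ ((Finset.range M).image (fun i : ℕ => (i : ℤ) + 1) ∪
          (Finset.range M).image (fun i : ℕ => -((i : ℤ) + 1))) := by
      intro i hi
      obtain ⟨j, hj, rfl⟩ := Finset.mem_image.1 hi
      have h1 := abs_le.1 (Finset.mem_filter.1 hj).2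
      simp only [Finset.mem_union, Finset.mem_singleton, Finset.mem_image, Finset.mem_range]
      rcases lt_trichotomy (n - j) 0 with h | h | h
      · exact Or.inr (Or.inr ⟨(-(n - j) - 1).toNat, by omega, by omega⟩)
      · exact Or.inl h
      · exact Or.inr (Or.inl ⟨((n - j) - 1).toNat, by omega, by omega⟩)
    have union_le : ∀ s t : Finset ℤ, ∑ i ∈ s ∪ t, f i ≤ ∑ i ∈ s, f i + ∑ i ∈ t, f i := by
      intro s t
      rw [← Finset.sum_union_inter]
      exact le_add_of_nonneg_right (Finset.sum_nonneg fun i _ => hf0 i)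
    refine (Finset.sum_le_sum_of_subset_of_nonneg hsub fun i _ _ => hf0 i).trans ?_
    refine (union_le _ _).trans ((add_le_add_right (union_le _ _) _).trans ?_)
    rw [Finset.sum_singleton, Finset.sum_image (by intro a _ b _ h; dsimp only at h; omega),
      Finset.sum_image (by intro a _ b _ h; dsimp only at h; omega)]
    have e0 : f 0 = 1 := by simp [hf]
    have hmax : ∀ i : ℕ, max 1 |(i : ℝ) + 1| = i + 1 := fun i => by
      rw [abs_of_nonneg (by positivity)]; exact max_eq_right (by linarith [i.cast_nonneg (α := ℝ)])
    have e1 : ∀ i : ℕ, f ((i : ℤ) + 1) = 1 / √((i : ℝ) + 1) := fun i => by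
      simp only [hf]; push_cast; rw [hmax]
    have e2 : ∀ i : ℕ, f (-((i : ℤ) + 1)) = 1 / √((i : ℝ) + 1) := fun i => by
      simp only [hf]; push_cast; rw [abs_neg, hmax]
    simp only [e0, e1, e2]
    linarith [sum_inv_sqrt_le M]
  have hsplit := Finset.sum_filter_add_sum_filter_not (box M) (fun j => |n - j| ≤ (M : ℤ))
    (fun j => f (n - j))
  change ∑ j ∈ box M, f (n - j) ≤ _
  linarith

/-- Counting pairs `(x, y)` with `ε₁⟨x⟩ + ε₂⟨y⟩ + ε₃⟨n - x - y⟩` in a bounded interval. -/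
lemma pair_card_le {ε₁ ε₂ ε₃ μ : ℝ} (hε₁ : ε₁ = -1 ∨ ε₁ = 1) (hε₃ : ε₃ = -1 ∨ ε₃ = 1)
    {N M : ℕ} (hN : 1 ≤ N) (hM : 1 ≤ M) (n₀ n₁ : ℤ) {P : Finset ((ℤ × ℤ) × (ℤ × ℤ))}
    (hP : ∀ p ∈ P, (N : ℝ) ^ 2 / 4 ≤ (p.2.1 : ℝ) ^ 2 + (p.2.2 : ℝ) ^ 2 ∧
      (p.2.1 : ℝ) ^ 2 + (p.2.2 : ℝ) ^ 2 ≤ 4 * (N : ℝ) ^ 2 ∧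
      (p.1.1 : ℝ) ^ 2 + (p.1.2 : ℝ) ^ 2 ≤ 4 * (M : ℝ) ^ 2 ∧
      |ε₁ * bracket p.2.1 p.2.2 + ε₂ * bracket p.1.1 p.1.2 +
        ε₃ * bracket (n₀ - p.1.1 - p.2.1) (n₁ - p.1.2 - p.2.2) - μ| ≤ 1) :
    (P.card : ℝ) ≤ 118000 * (N ^ 2 * (M * √M) + M ^ 2 * (N * √N)) := by
  have hmap : ∀ p ∈ P, p.1 ∈ box M ×ˢ box M := by
    intro p hp
    have := (hP p hp).2.2.1
    rw [Finset.mem_product]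
    exact ⟨mem_box_of_sq_le (by nlinarith), mem_box_of_sq_le (by nlinarith)⟩
  have hsq : ε₁ * ε₁ = 1 := by rcases hε₁ with rfl | rfl <;> norm_num
  have habs : |ε₁| = 1 := by rcases hε₁ with rfl | rfl <;> norm_num
  have hfib : ∀ y ∈ box M ×ˢ box M, ((P.filter fun p => p.1 = y).card : ℝ) ≤
      2360 * (N ^ 2 * (1 / √(max 1 |((n₀ - y.1 : ℤ) : ℝ)|)) + N * √N) := by
    intro y _
    have hinj : Set.InjOn (Prod.snd : (ℤ × ℤ) × (ℤ × ℤ) → ℤ × ℤ) (P.filter fun p => p.1 = y) := by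
      intro p hp q hq hpq
      simp only [Finset.coe_filter, Set.mem_ofPred_eq] at hp hq
      exact Prod.ext (hp.2.trans hq.2.symm) hpq
    rw [← Finset.card_image_of_injOn hinj, mul_one_div]
    refine level_card_le (ε := ε₁ * ε₃) (μ := ε₁ * (μ - ε₂ * bracket y.1 y.2))
      (by rcases hε₁ with rfl | rfl <;> rcases hε₃ with rfl | rfl <;> norm_num) hN
      (n₀ - y.1) (n₁ - y.2) ?_
    intro x hx
    obtain ⟨p, hp, rfl⟩ := Finset.mem_image.1 hx
    obtain ⟨hpP, rfl⟩ := Finset.mem_filter.1 hp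
    obtain ⟨h1, h2, -, h4⟩ := hP p hpP
    refine ⟨h1, h2, ?_⟩
    refine le_of_eq_of_le ?_ h4
    refine (one_mul _).symm.trans ?_
    rw [← habs, ← abs_mul]
    congr 1
    linear_combination (ε₃ * bracket (n₀ - p.1.1 - p.2.1) (n₁ - p.1.2 - p.2.2) - μ +
      ε₂ * bracket p.1.1 p.1.2) * hsq
  rw [Finset.card_eq_sum_card_fiberwise hmap]
  push_cast
  refine (Finset.sum_le_sum hfib).trans ?_
  rw [Finset.sum_product]
  have hin : ∑ j ∈ box M, (2360 * ((N : ℝ) ^ 2 * (1 / √(max 1 |((n₀ - j : ℤ) : ℝ)|)) + N * √N))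
      ≤ 2360 * ((N : ℝ) ^ 2 * (10 * √M) + 5 * M * (N * √N)) := by
    rw [← Finset.mul_sum, Finset.sum_add_distrib, ← Finset.mul_sum, Finset.sum_const,
      nsmul_eq_mul]
    gcongr
    · exact sum_box_inv_sqrt_le hM n₀
    · exact box_card_le hM
  simp only [Finset.sum_const, nsmul_eq_mul]
  rw [← Finset.mul_sum]
  calc ((box M).card : ℝ) * _
      ≤ 5 * M * (2360 * ((N : ℝ) ^ 2 * (10 * √M) + 5 * M * (N * √N))) := by
        gcongr
        exact box_card_le hM
    _ ≤ _ := by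
        have : (0 : ℝ) ≤ M ^ 2 * (N * √N) := by positivity
        nlinarith

lemma sq_bounds_of_ann {N : ℝ} (hN : 0 ≤ N) {x : Fin 2 → ℤ} (h : ann N x) :
    N ^ 2 / 4 ≤ (x 0 : ℝ) ^ 2 + (x 1 : ℝ) ^ 2 ∧
      (x 0 : ℝ) ^ 2 + (x 1 : ℝ) ^ 2 ≤ 4 * N ^ 2 := by
  have hz : znorm x ^ 2 = (x 0 : ℝ) ^ 2 + (x 1 : ℝ) ^ 2 := Real.sq_sqrt (by positivity)
  have h0 : 0 ≤ znorm x := Real.sqrt_nonneg _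
  rw [← hz]
  exact ⟨by nlinarith [h.1], by nlinarith [h.2]⟩

/-- Counting triples with fixed sum through the values of two of the three entries. -/
lemma triple_ncard_le {ε₁ ε₂ ε₃ μ : ℝ} (hε₁ : ε₁ = -1 ∨ ε₁ = 1) (hε₃ : ε₃ = -1 ∨ ε₃ = 1)
    {N M : ℕ} (hN : 1 ≤ N) (hM : 1 ≤ M) (n : Fin 2 → ℤ) (e : Equiv.Perm (Fin 3))
    {T : Set (Fin 3 → Fin 2 → ℤ)}
    (hT : ∀ v ∈ T, ann N (v (e 0)) ∧ ann M (v (e 1)) ∧ v (e 0) + v (e 1) + v (e 2) = n ∧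
      |ε₁ * jb (v (e 0)) + ε₂ * jb (v (e 1)) + ε₃ * jb (v (e 2)) - μ| ≤ 1) :
    T.Finite ∧ (T.ncard : ℝ) ≤ 118000 * (N ^ 2 * (M * √M) + M ^ 2 * (N * √N)) := by
  set F : (Fin 3 → Fin 2 → ℤ) → (ℤ × ℤ) × (ℤ × ℤ) := fun v =>
    ((v (e 1) 0, v (e 1) 1), (v (e 0) 0, v (e 0) 1)) with hF
  have hinj : Set.InjOn F T := by
    intro v hv w hw h
    simp only [hF, Prod.mk.injEq] at h
    obtain ⟨⟨h1, h2⟩, h3, h4⟩ := h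
    have e0 : v (e 0) = w (e 0) := by ext i; fin_cases i <;> assumption
    have e1 : v (e 1) = w (e 1) := by ext i; fin_cases i <;> assumption
    have e2 : v (e 2) = w (e 2) := by
      have h := (hT v hv).2.2.1.trans (hT w hw).2.2.1.symm
      rw [e0, e1] at h
      exact add_left_cancel h
    ext1 i
    obtain ⟨j, rfl⟩ := e.surjective i
    fin_cases j <;> assumption
  have hmem : ∀ v ∈ T, F v ∈ (box M ×ˢ box M) ×ˢ (box N ×ˢ box N) := by
    intro v hv
    have h1 := (sq_bounds_of_ann (Nat.cast_nonneg _) (hT v hv).1).2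
    have h2 := (sq_bounds_of_ann (Nat.cast_nonneg _) (hT v hv).2.1).2
    simp only [hF, Finset.mem_product]
    refine ⟨⟨?_, ?_⟩, ?_, ?_⟩ <;> apply mem_box_of_sq_le <;> nlinarith
  have hfinI : (F '' T).Finite :=
    (Finset.finite_toSet ((box M ×ˢ box M) ×ˢ (box N ×ˢ box N))).subset
      (Set.image_subset_iff.2 hmem)
  refine ⟨hfinI.of_finite_image hinj, ?_⟩
  rw [← hinj.ncard_image, Set.ncard_eq_toFinset_card _ hfinI]
  refine pair_card_le (ε₂ := ε₂) (μ := μ) hε₁ hε₃ hN hM (n 0) (n 1) ?_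
  intro p hp
  obtain ⟨v, hv, rfl⟩ := hfinI.mem_toFinset.1 hp
  obtain ⟨h1, h2, h3, h4⟩ := hT v hv
  have h1' := sq_bounds_of_ann (Nat.cast_nonneg _) h1
  refine ⟨h1'.1, h1'.2, (sq_bounds_of_ann (Nat.cast_nonneg _) h2).2, ?_⟩
  have c : ∀ i, n i - v (e 1) i - v (e 0) i = v (e 2) i := fun i => by
    rw [← h3]; simp only [Pi.add_apply]; ring
  simp only [hF, c]
  exact h4

lemma sqrt_bound_le {a b : ℝ} (ha : 1 ≤ a) (hb : 1 ≤ b) :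
    118000 * (a ^ 2 * (b * √b) + b ^ 2 * (a * √a)) ≤
      236000 * max a b ^ 2 * min a b ^ ((3 : ℝ) / 2) := by
  have hpow : ∀ c : ℝ, 1 ≤ c → c ^ ((3 : ℝ) / 2) = c * √c := fun c hc => by
    rw [show (3 : ℝ) / 2 = 1 + 1 / 2 by norm_num, Real.rpow_add (by linarith), Real.rpow_one,
      ← Real.sqrt_eq_rpow]
  have key : ∀ c d : ℝ, 1 ≤ c → c ≤ d → c ^ 2 * (d * √d) ≤ d ^ 2 * (c * √c) := by
    intro c d hc hcd
    have hc0 : 0 ≤ c := by linarith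
    have hd0 : 0 ≤ d := by linarith
    have h1 : √c ≤ √d := Real.sqrt_le_sqrt hcd
    have h2 : √c * √c = c := Real.mul_self_sqrt hc0
    have h3 : √d * √d = d := Real.mul_self_sqrt hd0
    calc c ^ 2 * (d * √d) = c * d * √d * (√c * √c) := by rw [h2]; ring
      _ ≤ c * d * √d * (√c * √d) := by gcongr
      _ = c * d * √c * (√d * √d) := by ring
      _ = d ^ 2 * (c * √c) := by rw [h3]; ring
  rcases le_total a b with h | h
  · rw [max_eq_right h, min_eq_left h, hpow a ha]
    linarith [key a b ha h]
  · rw [max_eq_left h, min_eq_right h, hpow b hb]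
    linarith [key b a hb h]


/-- cubic sup-counting estimate, first form: there is a universal `C > 0` such
that for all signs, dyadic `N₁, N₂, N₃`, every `m ∈ ℤ` and every `n ∈ ℤ²`,
`#{(n₁,n₂,n₃) : |n_j| ∼ N_j, n₁+n₂+n₃ = n, |φ−m| ≤ 1}
  ≤ C med(N₁,N₂,N₃)² min(N₁,N₂,N₃)^{3/2}`. -/
theorem cubic_sup_counting_i :
    ∃ C : ℝ, 0 < C ∧
      ∀ (σ σ₁ σ₂ σ₃ : ℝ), (σ = -1 ∨ σ = 1) → (σ₁ = -1 ∨ σ₁ = 1) →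
        (σ₂ = -1 ∨ σ₂ = 1) → (σ₃ = -1 ∨ σ₃ = 1) →
        ∀ (k₁ k₂ k₃ : ℕ) (m : ℤ) (n : Fin 2 → ℤ),
          (cubicSupSet σ σ₁ σ₂ σ₃ ((2:ℝ)^k₁) ((2:ℝ)^k₂) ((2:ℝ)^k₃) n m).Finite ∧
          ((cubicSupSet σ σ₁ σ₂ σ₃ ((2:ℝ)^k₁) ((2:ℝ)^k₂) ((2:ℝ)^k₃) n m).ncard : ℝ) ≤
            C * (med3 ((2:ℝ)^k₁) ((2:ℝ)^k₂) ((2:ℝ)^k₃)) ^ 2 *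
              (min ((2:ℝ)^k₁) (min ((2:ℝ)^k₂) ((2:ℝ)^k₃))) ^ ((3:ℝ)/2) := by
  refine ⟨236000, by norm_num, ?_⟩
  intro σ σ₁ σ₂ σ₃ _ h₁ h₂ h₃ k₁ k₂ k₃ m n
  have hpos : ∀ k : ℕ, 1 ≤ 2 ^ k := fun k => Nat.one_le_two_pow
  have hpos' : ∀ k : ℕ, (1 : ℝ) ≤ 2 ^ k := fun k => one_le_pow₀ (by norm_num)
  have hcast : ∀ k : ℕ, ((2 ^ k : ℕ) : ℝ) = 2 ^ k := fun k => by push_cast; rfl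
  have conclude : ∀ (ε₁ ε₂ ε₃ : ℝ) (i j : ℕ) (e : Equiv.Perm (Fin 3)),
      (ε₁ = -1 ∨ ε₁ = 1) → (ε₃ = -1 ∨ ε₃ = 1) →
      max ((2 : ℝ) ^ i) (2 ^ j) = med3 ((2 : ℝ) ^ k₁) (2 ^ k₂) (2 ^ k₃) →
      min ((2 : ℝ) ^ i) (2 ^ j) = min ((2 : ℝ) ^ k₁) (min (2 ^ k₂) (2 ^ k₃)) →
      (∀ v ∈ cubicSupSet σ σ₁ σ₂ σ₃ (2 ^ k₁) (2 ^ k₂) (2 ^ k₃) n m,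
        ann (2 ^ i) (v (e 0)) ∧ ann (2 ^ j) (v (e 1)) ∧ v (e 0) + v (e 1) + v (e 2) = n ∧
        |ε₁ * jb (v (e 0)) + ε₂ * jb (v (e 1)) + ε₃ * jb (v (e 2)) - (m - σ * jb n)| ≤ 1) →
      (cubicSupSet σ σ₁ σ₂ σ₃ (2 ^ k₁) (2 ^ k₂) (2 ^ k₃) n m).Finite ∧
      ((cubicSupSet σ σ₁ σ₂ σ₃ (2 ^ k₁) (2 ^ k₂) (2 ^ k₃) n m).ncard : ℝ) ≤
        236000 * (med3 ((2 : ℝ) ^ k₁) (2 ^ k₂) (2 ^ k₃)) ^ 2 *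
          (min ((2 : ℝ) ^ k₁) (min (2 ^ k₂) (2 ^ k₃))) ^ ((3 : ℝ) / 2) := by
    intro ε₁ ε₂ ε₃ i j e hε₁ hε₃ hmax hmin hT
    rw [← hmax, ← hmin]
    simp only [← hcast i, ← hcast j] at hT
    have h := triple_ncard_le hε₁ hε₃ (hpos i) (hpos j) n e hT
    rw [hcast, hcast] at h
    exact ⟨h.1, h.2.trans (sqrt_bound_le (hpos' i) (hpos' j))⟩
  have hphase : ∀ v ∈ cubicSupSet σ σ₁ σ₂ σ₃ (2 ^ k₁) (2 ^ k₂) (2 ^ k₃) n m,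
      |σ₁ * jb (v 0) + σ₂ * jb (v 1) + σ₃ * jb (v 2) - (m - σ * jb n)| ≤ 1 := by
    rintro v ⟨-, -, -, hs, hv⟩
    rw [phase, hs] at hv
    convert hv using 2
    ring
  have hmedian : ∀ a b c : ℝ,
      (max a b = med3 a b c ∧ min a b = min a (min b c)) ∨
      (max a c = med3 a b c ∧ min a c = min a (min b c)) ∨
      (max b c = med3 a b c ∧ min b c = min a (min b c)) := by
    intro a b c
    unfold med3
    grind
  rcases hmedian ((2 : ℝ) ^ k₁) (2 ^ k₂) (2 ^ k₃) with ⟨hmax, hmin⟩ | ⟨hmax, hmin⟩ | ⟨hmax, hmin⟩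
  · refine conclude σ₁ σ₂ σ₃ k₁ k₂ (Equiv.refl _) h₁ h₃ hmax hmin fun v hv => ?_
    exact ⟨hv.1, hv.2.1, hv.2.2.2.1, hphase v hv⟩
  · refine conclude σ₁ σ₃ σ₂ k₁ k₃ (Equiv.swap 1 2) h₁ h₂ hmax hmin fun v hv => ?_
    have e0 : Equiv.swap (1 : Fin 3) 2 0 = 0 := by decide
    have e1 : Equiv.swap (1 : Fin 3) 2 1 = 2 := by decide
    have e2 : Equiv.swap (1 : Fin 3) 2 2 = 1 := by decide
    rw [e0, e1, e2]
    refine ⟨hv.1, hv.2.2.1, ?_, ?_⟩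
    · rw [← hv.2.2.2.1]; abel
    · convert hphase v hv using 2; ring
  · refine conclude σ₃ σ₂ σ₁ k₃ k₂ (Equiv.swap 0 2) h₃ h₁ ((max_comm _ _).trans hmax)
      ((min_comm _ _).trans hmin) fun v hv => ?_
    have e0 : Equiv.swap (0 : Fin 3) 2 0 = 2 := by decide
    have e1 : Equiv.swap (0 : Fin 3) 2 1 = 1 := by decide
    have e2 : Equiv.swap (0 : Fin 3) 2 2 = 0 := by decide
    rw [e0, e1, e2]
    refine ⟨hv.2.2.1, hv.2.1, ?_, ?_⟩
    · rw [← hv.2.2.2.1]; abel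
    · convert hphase v hv using 2; ring
end
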